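/- Let Ω be a standard Borel space equipped with a probability measure P, and let 𝒳, ℋ, 𝒵, 𝒴 be standard Borel spaces. Let X : Ω → 𝒳 and η : Ω → ℋ be measurable maps that are independent under P, let b : 𝒳 → 𝒵 and f : 𝒵 × ℋ → 𝒴 be measurable, and define Y : Ω → 𝒴 by Y(ω) := f(b(X(ω)), η(ω)). Then Y and X are conditionally independent given the bottleneck variable Z := b ∘ X (i.e., given the σ-algebra generated by b ∘ X). -/

import Mathlib

open MeasureTheory ProbabilityTheory

lemma scbm_aux {Ω ℋ 𝒵 𝒴 γ : Type*}
    [MeasurableSpace Ω] [MeasurableSpace ℋ] [MeasurableSpace 𝒵] [MeasurableSpace 𝒴]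
    [MeasurableSpace γ] (P : Measure Ω) [IsProbabilityMeasure P]
    (W : Ω → γ) (η : Ω → ℋ) (hW : Measurable W) (hη : Measurable η)
    (hindep : IndepFun W η P) (g : γ → 𝒵) (hg : Measurable g)
    (f : 𝒵 × ℋ → 𝒴) (hf : Measurable f) :
    P.map (fun ω => (W ω, f (g (W ω), η ω))) =
      P.map W ⊗ₘ (((Kernel.id ×ₖ Kernel.const 𝒵 (P.map η)).map f).comap g hg) := by
  have : IsProbabilityMeasure (P.map η) := Measure.isProbabilityMeasure_map hη.aemeasurable
  have : IsProbabilityMeasure (P.map W) := Measure.isProbabilityMeasure_map hW.aemeasurable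
  have : IsMarkovKernel ((Kernel.id ×ₖ Kernel.const 𝒵 (P.map η)).map f) :=
    Kernel.IsMarkovKernel.map _ hf
  have hm : Measurable (fun p : γ × ℋ => (p.1, f (g p.1, p.2))) := by fun_prop
  have h1 : P.map (fun ω => (W ω, f (g (W ω), η ω))) =
      ((P.map W).prod (P.map η)).map (fun p : γ × ℋ => (p.1, f (g p.1, p.2))) := by
    rw [← (indepFun_iff_map_prod_eq_prod_map_map hW.aemeasurable hη.aemeasurable).1 hindep,
      Measure.map_map hm (by fun_prop)]
    rfl
  rw [h1]
  ext s hs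
  rw [Measure.map_apply hm hs, Measure.prod_apply (hm hs), Measure.compProd_apply hs]
  congr 1
  ext w
  have hs' : MeasurableSet (Prod.mk w ⁻¹' s) := measurable_prodMk_left hs
  rw [Kernel.comap_apply, Kernel.map_apply' _ hf _ hs', Kernel.prod_apply, Kernel.id_apply,
    Kernel.const_apply, Measure.dirac_prod, Measure.map_apply (by fun_prop) (hf hs')]
  rfl

/-- **A child is conditionally independent of its parent given the bottleneck.**
Let `Ω` be a standard Borel probability space and `X : Ω → 𝒳`, `η : Ω → ℋ` independent
measurable maps. For measurable `b : 𝒳 → 𝒵` and `f : 𝒵 × ℋ → 𝒴`, the variable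
`Y := f (b (X ·), η ·)` is conditionally independent of `X` given the σ-algebra generated
by the bottleneck variable `Z := b ∘ X`. -/
theorem scbm_child_condIndep_parent_given_bottleneck
    {Ω 𝒳 ℋ 𝒵 𝒴 : Type*}
    [MeasurableSpace Ω] [StandardBorelSpace Ω]
    [MeasurableSpace 𝒳] [StandardBorelSpace 𝒳]
    [MeasurableSpace ℋ] [StandardBorelSpace ℋ]
    [MeasurableSpace 𝒵] [StandardBorelSpace 𝒵]
    [MeasurableSpace 𝒴] [StandardBorelSpace 𝒴]
    (P : Measure Ω) [IsProbabilityMeasure P]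
    (X : Ω → 𝒳) (η : Ω → ℋ) (hX : Measurable X) (hη : Measurable η)
    (hindep : IndepFun X η P)
    (b : 𝒳 → 𝒵) (hb : Measurable b)
    (f : 𝒵 × ℋ → 𝒴) (hf : Measurable f)
    (Y : Ω → 𝒴) (hY : Y = fun ω => f (b (X ω), η ω)) :
    CondIndepFun (MeasurableSpace.comap (b ∘ X) inferInstance)
      ((hb.comp hX).comap_le) Y X P := by
  subst hY
  have : Nonempty Ω := P.nonempty_of_neZero
  have : Nonempty 𝒳 := this.map X
  have : Nonempty 𝒴 := ‹Nonempty Ω›.map (fun ω => f (b (X ω), η ω))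
  have : IsProbabilityMeasure (P.map η) := Measure.isProbabilityMeasure_map hη.aemeasurable
  have : IsMarkovKernel ((Kernel.id ×ₖ Kernel.const 𝒵 (P.map η)).map f) :=
    Kernel.IsMarkovKernel.map _ hf
  have hYm : Measurable (fun ω => f (b (X ω), η ω)) := by fun_prop
  have hZ : Measurable (b ∘ X) := hb.comp hX
  apply CondIndepFun.symm
  refine (condIndepFun_iff_condDistrib_prod_ae_eq_prodMkRight hYm hX hZ).2 ?_
  have h1 := condDistrib_ae_eq_of_measure_eq_compProd (b ∘ X) hYm.aemeasurable
    (scbm_aux P (b ∘ X) η hZ hη (hindep.comp hb measurable_id) id measurable_id f hf)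
  have hZX : Measurable (fun ω => ((b ∘ X) ω, X ω)) := by fun_prop
  have h2 := condDistrib_ae_eq_of_measure_eq_compProd (fun ω => ((b ∘ X) ω, X ω)) hYm.aemeasurable
    (scbm_aux P (fun ω => ((b ∘ X) ω, X ω)) η hZX hη
      (hindep.comp (φ := fun x => (b x, x)) (by fun_prop) measurable_id)
      Prod.fst measurable_fst f hf)
  have h3 : ∀ᵐ p ∂(P.map (fun ω => ((b ∘ X) ω, X ω))),
      condDistrib (fun ω => f (b (X ω), η ω)) (b ∘ X) P p.1 =
      (((Kernel.id ×ₖ Kernel.const 𝒵 (P.map η)).map f).comap id measurable_id) p.1 := by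
    have h4 : (P.map (fun ω => ((b ∘ X) ω, X ω))).map Prod.fst = P.map (b ∘ X) := by
      rw [Measure.map_map measurable_fst hZX]
      rfl
    rw [← h4] at h1
    exact ae_of_ae_map measurable_fst.aemeasurable h1
  filter_upwards [h2, h3] with p hp2 hp3
  rw [hp2, Kernel.prodMkRight_apply, hp3]
  rfl
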